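/- Integrality criterion for orthoplicial Apollonian sphere packings. Let x be an orthoplicial sphere packing and set κᵢ := κ'(xᵢ) for i = 1,2,3,4 (the curvatures of four pairwise tangent spheres of the packing). Then the orthoplicial Apollonian packing Ω(x) is integral if and only if κ₁, κ₂, κ₃, κ₄ are integers and there exists an integer n with 4n² = (κ₁+κ₂+κ₃+κ₄)² − 2(κ₁²+κ₂²+κ₃²+κ₄²), i.e. the square root of 𝔗₃(κ₁,κ₂,κ₃,κ₄) := ½(½(κ₁+κ₂+κ₃+κ₄)² − (κ₁²+κ₂²+κ₃²+κ₄²)) is an integer. -/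

import Mathlib

noncomputable section

/-- Inversive product on ℝ⁵. -/
def Q3 (a b : Fin 5 → ℝ) : ℝ := a 0 * b 0 + a 1 * b 1 + a 2 * b 2 + a 3 * b 3 - a 4 * b 4

/-- Curvature of a sphere in inversive coordinates. -/
def curv3 (a : Fin 5 → ℝ) : ℝ := a 4 - a 3

/-- An orthoplicial sphere packing, indexed by `{±1,±2,±3,±4}` (here `Fin 4 × Bool`,
with negation flipping the boolean; `true` stands for the positive indices). -/
def IsOrthoPacking (x : Fin 4 × Bool → (Fin 5 → ℝ)) : Prop :=
  (∀ k, Q3 (x k) (x k) = 1) ∧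
  (∀ k l, l ≠ k → l ≠ (k.1, !k.2) → Q3 (x k) (x l) = -1) ∧
  (∀ k, Q3 (x k) (x (k.1, !k.2)) = -3)

/-- Generators of the orthoplicial Apollonian group. -/
def orthoGens (x : Fin 4 × Bool → (Fin 5 → ℝ)) : Set ((Fin 5 → ℝ) ≃ₗ[ℝ] (Fin 5 → ℝ)) :=
  {g | ∃ w : Fin 5 → ℝ, Q3 w w = 1 ∧ (∃ ε : Fin 4 → Bool, ∀ i, Q3 w (x (i, ε i)) = 0) ∧
        ∀ z, g z = z - (2 * Q3 z w) • w}

/-- The orthoplicial Apollonian packing. -/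
def orthoOmega (x : Fin 4 × Bool → (Fin 5 → ℝ)) : Set (Fin 5 → ℝ) :=
  {b | ∃ g ∈ Subgroup.closure (orthoGens x), ∃ k, b = g (x k)}

theorem Q3_comm (a b : Fin 5 → ℝ) : Q3 a b = Q3 b a := by
  unfold Q3; ring

/-- The inversive product as a bilinear form. -/
def inversiveForm : LinearMap.BilinForm ℝ (Fin 5 → ℝ) :=
  LinearMap.mk₂ ℝ Q3
    (fun a b c => by simp only [Q3, Pi.add_apply]; ring)
    (fun r a b => by simp only [Q3, Pi.smul_apply, smul_eq_mul]; ring)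
    (fun a b c => by simp only [Q3, Pi.add_apply]; ring)
    (fun r a b => by simp only [Q3, Pi.smul_apply, smul_eq_mul]; ring)

theorem inversiveForm_apply (a b : Fin 5 → ℝ) : inversiveForm a b = Q3 a b := rfl

theorem Q3_add_left (a b c : Fin 5 → ℝ) : Q3 (a + b) c = Q3 a c + Q3 b c :=
  LinearMap.map_add₂ inversiveForm a b c

theorem Q3_sub_left (a b c : Fin 5 → ℝ) : Q3 (a - b) c = Q3 a c - Q3 b c :=
  LinearMap.map_sub₂ inversiveForm a b c

theorem Q3_smul_left (r : ℝ) (a b : Fin 5 → ℝ) : Q3 (r • a) b = r * Q3 a b :=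
  LinearMap.map_smul₂ inversiveForm r a b

theorem Q3_add_right (a b c : Fin 5 → ℝ) : Q3 a (b + c) = Q3 a b + Q3 a c :=
  map_add (inversiveForm a) b c

theorem Q3_sub_right (a b c : Fin 5 → ℝ) : Q3 a (b - c) = Q3 a b - Q3 a c :=
  map_sub (inversiveForm a) b c

theorem Q3_smul_right (r : ℝ) (a b : Fin 5 → ℝ) : Q3 a (r • b) = r * Q3 a b :=
  map_smul (inversiveForm a) r b

theorem eq_zero_of_forall_Q3_eq_zero {u : Fin 5 → ℝ} (h : ∀ z, Q3 u z = 0) : u = 0 := by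
  funext i
  have := h (Pi.single i 1)
  fin_cases i <;> simpa [Q3] using this

/-- The isotropic vector representing the curvature functional. -/
def curvVector : Fin 5 → ℝ := ![0, 0, 0, -1, -1]

theorem Q3_curvVector (a : Fin 5 → ℝ) : Q3 a curvVector = curv3 a := by
  simp only [Q3, curvVector, curv3, Matrix.cons_val]; ring

theorem curv3_curvVector : curv3 curvVector = 0 := by
  simp [curvVector, curv3]

theorem curv3_add (a b : Fin 5 → ℝ) : curv3 (a + b) = curv3 a + curv3 b := by
  simp only [← Q3_curvVector, Q3_add_left]

theorem curv3_sub (a b : Fin 5 → ℝ) : curv3 (a - b) = curv3 a - curv3 b := by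
  simp only [← Q3_curvVector, Q3_sub_left]

theorem curv3_smul (r : ℝ) (a : Fin 5 → ℝ) : curv3 (r • a) = r * curv3 a := by
  simp only [← Q3_curvVector, Q3_smul_left]

/-- An orthogonal frame consisting of the center `m` of an orthoplex and the displacements `d i`
from the center to four pairwise non-opposite vertices. -/
structure IsOrthoFrame (m : Fin 5 → ℝ) (d : Fin 4 → Fin 5 → ℝ) : Prop where
  center : Q3 m m = -1
  center_disp : ∀ i, Q3 m (d i) = 0
  disp : ∀ i j, Q3 (d i) (d j) = if i = j then 2 else 0

/-- The sign attached to a boolean. -/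
def boolSign (b : Bool) : ℝ := if b then 1 else -1

theorem exists_boolSign_eq (b : Bool) : ∃ c : ℤ, boolSign b = 1 - 2 * c := by
  cases b
  · exact ⟨1, by norm_num [boolSign]⟩
  · exact ⟨0, by norm_num [boolSign]⟩

theorem exists_boolSign_mul_eq (a b : Bool) : ∃ c : ℤ, boolSign a * boolSign b = 1 - 2 * c := by
  cases a <;> cases b
  · exact ⟨0, by norm_num [boolSign]⟩
  · exact ⟨1, by norm_num [boolSign]⟩
  · exact ⟨1, by norm_num [boolSign]⟩
  · exact ⟨0, by norm_num [boolSign]⟩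

theorem boolSign_mul_self (b : Bool) : boolSign b * boolSign b = 1 := by
  cases b <;> norm_num [boolSign]

/-- The unit vector orthogonal to the four vertices `m + boolSign (ε i) • d i`. -/
def facetVector (m : Fin 5 → ℝ) (d : Fin 4 → Fin 5 → ℝ) (ε : Fin 4 → Bool) : Fin 5 → ℝ :=
  m + (1 / 2 : ℝ) • ∑ i, boolSign (ε i) • d i

theorem Q3_facetVector (m : Fin 5 → ℝ) (d : Fin 4 → Fin 5 → ℝ) (ε : Fin 4 → Bool)
    (z : Fin 5 → ℝ) :
    Q3 z (facetVector m d ε) = Q3 z m + 1 / 2 * ∑ i, boolSign (ε i) * Q3 z (d i) := by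
  simp only [facetVector, Fin.sum_univ_four, Q3_add_right, Q3_smul_right]

theorem curv3_facetVector (m : Fin 5 → ℝ) (d : Fin 4 → Fin 5 → ℝ) (ε : Fin 4 → Bool) :
    curv3 (facetVector m d ε) = curv3 m + 1 / 2 * ∑ i, boolSign (ε i) * curv3 (d i) := by
  simp only [facetVector, Fin.sum_univ_four, curv3_add, curv3_smul]

theorem even_sum_sq_iff (a : Fin 4 → ℤ) : Even (∑ i, a i ^ 2) ↔ Even (∑ i, a i) := by
  simp [Fin.sum_univ_four, Int.even_add, Int.even_pow]

namespace IsOrthoFrame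

variable {m : Fin 5 → ℝ} {d : Fin 4 → Fin 5 → ℝ}

theorem disp_center (h : IsOrthoFrame m d) (i : Fin 4) : Q3 (d i) m = 0 := by
  rw [Q3_comm, h.center_disp]

theorem span_eq_top (h : IsOrthoFrame m d) :
    Submodule.span ℝ (Set.range (Fin.cons m d : Fin 5 → Fin 5 → ℝ)) = ⊤ := by
  have hli : LinearIndependent ℝ (Fin.cons m d : Fin 5 → Fin 5 → ℝ) := by
    apply LinearMap.linearIndependent_of_isOrthoᵢ (B := inversiveForm)
    · rw [LinearMap.isOrthoᵢ_def]
      intro i j hij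
      rw [inversiveForm_apply]
      induction i using Fin.cases <;> induction j using Fin.cases <;>
        simp_all [h.center_disp, h.disp_center, h.disp]
    · intro i
      rw [inversiveForm_apply]
      induction i using Fin.cases <;> simp [h.center, h.disp]
  exact hli.span_eq_top_of_card_eq_finrank' (by simp)

theorem eq_zero (h : IsOrthoFrame m d) {u : Fin 5 → ℝ} (hm : Q3 u m = 0)
    (hd : ∀ i, Q3 u (d i) = 0) : u = 0 := by
  apply eq_zero_of_forall_Q3_eq_zero
  intro z
  have hle : Submodule.span ℝ (Set.range (Fin.cons m d : Fin 5 → Fin 5 → ℝ)) ≤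
      LinearMap.ker (inversiveForm u) := by
    rw [Submodule.span_le]
    rintro _ ⟨i, rfl⟩
    induction i using Fin.cases
    · simpa [inversiveForm_apply] using hm
    · simpa [inversiveForm_apply] using hd _
  rw [h.span_eq_top] at hle
  exact hle (Submodule.mem_top (x := z))

/-- The Descartes relation: the curvature functional is represented by an isotropic vector. -/
theorem curv3_relation (h : IsOrthoFrame m d) :
    2 * curv3 m ^ 2 = ∑ i, curv3 (d i) ^ 2 := by
  have h0 : curvVector + curv3 m • m - (1 / 2 : ℝ) • ∑ i, curv3 (d i) • d i = 0 := by
    apply h.eq_zero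
    · simp only [Fin.sum_univ_four, Q3_sub_left, Q3_add_left, Q3_smul_left, h.center,
        h.disp_center, Q3_comm curvVector, Q3_curvVector]
      ring
    · intro j
      simp only [Fin.sum_univ_four, Q3_sub_left, Q3_add_left, Q3_smul_left, h.center_disp, h.disp,
        Q3_comm curvVector, Q3_curvVector]
      fin_cases j <;> simp <;> ring
  have h1 := congrArg curv3 h0
  simp only [Fin.sum_univ_four, curv3_sub, curv3_add, curv3_smul, curv3_curvVector] at h1
  rw [show curv3 (0 : Fin 5 → ℝ) = 0 by simp [curv3]] at h1
  rw [Fin.sum_univ_four]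
  linarith

theorem Q3_facetVector_center (h : IsOrthoFrame m d) (ε : Fin 4 → Bool) :
    Q3 (facetVector m d ε) m = -1 := by
  rw [Q3_comm, Q3_facetVector]
  simp [h.center, h.center_disp]

theorem Q3_facetVector_disp (h : IsOrthoFrame m d) (ε : Fin 4 → Bool) (i : Fin 4) :
    Q3 (facetVector m d ε) (d i) = boolSign (ε i) := by
  rw [Q3_comm, Q3_facetVector]
  simp [h.disp_center, h.disp]
  ring

theorem exists_Q3_facetVector (h : IsOrthoFrame m d) (ε δ : Fin 4 → Bool) :
    ∃ n : ℤ, Q3 (facetVector m d ε) (facetVector m d δ) = n := by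
  choose c hc using fun i => exists_boolSign_mul_eq (δ i) (ε i)
  refine ⟨1 - ∑ i, c i, ?_⟩
  simp only [Q3_facetVector m d δ, h.Q3_facetVector_center, h.Q3_facetVector_disp, hc,
    Fin.sum_univ_four]
  push_cast
  ring

theorem exists_Q3_vertex_facetVector (h : IsOrthoFrame m d) (i : Fin 4) (b : Bool)
    (ε : Fin 4 → Bool) : ∃ n : ℤ, Q3 (m + boolSign b • d i) (facetVector m d ε) = n := by
  obtain ⟨c, hc⟩ := exists_boolSign_mul_eq b (ε i)
  refine ⟨-2 * c, ?_⟩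
  rw [Q3_comm, Q3_add_right, Q3_smul_right, h.Q3_facetVector_center, h.Q3_facetVector_disp, hc]
  push_cast
  ring

/-- A unit vector orthogonal to the vertices of a facet is the facet vector up to sign. -/
theorem eq_smul_facetVector (h : IsOrthoFrame m d) {w : Fin 5 → ℝ} (hw : Q3 w w = 1)
    {ε : Fin 4 → Bool} (hε : ∀ i, Q3 w (m + boolSign (ε i) • d i) = 0) :
    ∃ a : ℝ, a * a = 1 ∧ w = a • facetVector m d ε := by
  have hd : ∀ i, Q3 w (d i) = boolSign (ε i) * -Q3 w m := by
    intro i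
    have hi := hε i
    rw [Q3_add_right, Q3_smul_right] at hi
    linear_combination boolSign (ε i) * hi - Q3 w (d i) * boolSign_mul_self (ε i)
  have hw' : w = (-Q3 w m) • facetVector m d ε := by
    rw [← sub_eq_zero]
    apply h.eq_zero
    · rw [Q3_sub_left, Q3_smul_left, h.Q3_facetVector_center]
      ring
    · intro i
      rw [Q3_sub_left, Q3_smul_left, h.Q3_facetVector_disp, hd]
      ring
  refine ⟨-Q3 w m, ?_, hw'⟩
  have hs : Q3 w (facetVector m d ε) = -Q3 w m := by
    simp only [Q3_facetVector, hd, Fin.sum_univ_four]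
    linear_combination (-Q3 w m / 2) * (boolSign_mul_self (ε 0) + boolSign_mul_self (ε 1) +
      boolSign_mul_self (ε 2) + boolSign_mul_self (ε 3))
  have hww : Q3 w w = -Q3 w m * Q3 w (facetVector m d ε) :=
    (congrArg (Q3 w) hw').trans (Q3_smul_right _ _ _)
  rw [← hw, hww, hs]

/-- If the vertices have integral curvatures, then so do the center, the displacements and the
facet vectors. -/
theorem exists_curv3_eq (h : IsOrthoFrame m d) (hv : ∀ i, ∃ n : ℤ, curv3 (m + d i) = n)
    (hm : ∃ n : ℤ, 2 * curv3 m = n) :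
    (∃ n : ℤ, curv3 m = n) ∧ (∀ i, ∃ n : ℤ, curv3 (d i) = n) ∧
      ∀ ε, ∃ n : ℤ, curv3 (facetVector m d ε) = n := by
  choose k hk using hv
  obtain ⟨p, hp⟩ := hm
  have hrel := h.curv3_relation
  simp only [curv3_add] at hk
  have hd : ∀ i, curv3 (d i) = k i - p / 2 := fun i => by rw [← hk, ← hp]; ring
  have hpm : curv3 m = p / 2 := by rw [← hp]; ring
  have hp_even : Even p := by
    have hsq : p ^ 2 = 2 * (p * (∑ i, k i) - ∑ i, k i ^ 2) := by
      simp only [hd, hpm, Fin.sum_univ_four] at hrel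
      have : (p : ℝ) ^ 2 = 2 * (p * (∑ i, (k i : ℝ)) - ∑ i, (k i : ℝ) ^ 2) := by
        simp only [Fin.sum_univ_four]
        linear_combination (-2) * hrel
      exact_mod_cast this
    have : Even (p ^ 2) := hsq ▸ even_two_mul _
    exact (Int.even_pow' two_ne_zero).1 this
  obtain ⟨q, rfl⟩ := hp_even
  have hmq : curv3 m = q := by rw [hpm]; push_cast; ring
  have hdq : ∀ i, curv3 (d i) = (k i - q : ℤ) := fun i => by rw [hd]; push_cast; ring
  refine ⟨⟨q, hmq⟩, fun i => ⟨_, hdq i⟩, fun ε => ?_⟩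
  have hsum : Even (∑ i, (k i - q)) := by
    have hsq : 2 * q ^ 2 = ∑ i, (k i - q) ^ 2 := by
      simp only [hdq, hmq] at hrel
      exact_mod_cast hrel
    have : Even (∑ i, (k i - q) ^ 2) := hsq ▸ even_two_mul _
    exact (even_sum_sq_iff _).1 this
  obtain ⟨t, ht⟩ := hsum
  choose c hc using fun i => exists_boolSign_eq (ε i)
  refine ⟨q + t - ∑ i, c i * (k i - q), ?_⟩
  have ht' := congrArg (Int.cast : ℤ → ℝ) ht
  simp only [curv3_facetVector, hdq, hmq, hc, Fin.sum_univ_four] at ht' ⊢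
  push_cast at ht' ⊢
  linear_combination ht' / 2

end IsOrthoFrame

namespace IsOrthoPacking

variable {x : Fin 4 × Bool → Fin 5 → ℝ}

/-- The center of an orthoplicial sphere packing. -/
def center (x : Fin 4 × Bool → Fin 5 → ℝ) : Fin 5 → ℝ :=
  (1 / 2 : ℝ) • (x (0, true) + x (0, false))

/-- The displacement from the center of an orthoplicial sphere packing to a positive vertex. -/
def disp (x : Fin 4 × Bool → Fin 5 → ℝ) (i : Fin 4) : Fin 5 → ℝ :=
  x (i, true) - center x

theorem Q3_add_opposite (hx : IsOrthoPacking x) (i : Fin 4) (l : Fin 4 × Bool) :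
    Q3 (x (i, true) + x (i, false)) (x l) = -2 := by
  obtain ⟨h1, h2, h3⟩ := hx
  rw [Q3_add_left]
  obtain ⟨j, b⟩ := l
  by_cases hij : j = i
  · subst hij
    have ht := h1 (j, true)
    have hf := h1 (j, false)
    have htf := h3 (j, true)
    have hft := h3 (j, false)
    simp only [Bool.not_true, Bool.not_false] at htf hft
    cases b <;> linarith
  · rw [h2 (i, true) (j, b) (by simp [hij]) (by simp [hij]),
      h2 (i, false) (j, b) (by simp [hij]) (by simp [hij])]
    norm_num

theorem Q3_center (hx : IsOrthoPacking x) (l : Fin 4 × Bool) : Q3 (center x) (x l) = -1 := by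
  rw [center, Q3_smul_left, hx.Q3_add_opposite]
  norm_num

theorem Q3_center_self (hx : IsOrthoPacking x) : Q3 (center x) (center x) = -1 := by
  have h : Q3 (center x) ((1 / 2 : ℝ) • (x (0, true) + x (0, false))) = -1 := by
    rw [Q3_smul_right, Q3_add_right, hx.Q3_center, hx.Q3_center]
    norm_num
  exact h

theorem isOrthoFrame (hx : IsOrthoPacking x) : IsOrthoFrame (center x) (disp x) where
  center := hx.Q3_center_self
  center_disp i := by rw [disp, Q3_sub_right, hx.Q3_center, hx.Q3_center_self, sub_self]
  disp i j := by
    rw [disp, disp, Q3_sub_right, Q3_sub_left, Q3_sub_left, hx.Q3_center, hx.Q3_center_self,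
      Q3_comm _ (center x), hx.Q3_center]
    split_ifs with hij
    · rw [hij, hx.1]
      norm_num
    · rw [hx.2.1 _ _ (by simp [Ne.symm hij]) (by simp)]
      norm_num

theorem add_opposite (hx : IsOrthoPacking x) (i : Fin 4) :
    x (i, true) + x (i, false) = (2 : ℝ) • center x := by
  rw [← sub_eq_zero]
  have hl : ∀ l, Q3 (x (i, true) + x (i, false) - (2 : ℝ) • center x) (x l) = 0 := by
    intro l
    rw [Q3_sub_left, Q3_smul_left, hx.Q3_add_opposite, hx.Q3_center]
    norm_num
  have hm : Q3 (x (i, true) + x (i, false) - (2 : ℝ) • center x) (center x) = 0 := by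
    conv_lhs => arg 2; rw [center]
    rw [Q3_smul_right, Q3_add_right, hl, hl]
    norm_num
  refine hx.isOrthoFrame.eq_zero hm fun j => ?_
  rw [disp, Q3_sub_right, hl, hm, sub_zero]

theorem eq_center_add (hx : IsOrthoPacking x) (i : Fin 4) (b : Bool) :
    x (i, b) = center x + boolSign b • disp x i := by
  cases b
  · rw [eq_sub_of_add_eq' (hx.add_opposite i), disp]
    simp only [boolSign, Bool.false_eq_true, if_false]
    module
  · simp [boolSign, disp]

/-- Every element of the orthoplicial Apollonian group preserves the vectors having integral
curvature and integral products with all facet vectors, once the facet vectors have integral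
curvature. -/
theorem integral_apply_iff (hx : IsOrthoPacking x)
    (hw : ∀ ε, ∃ n : ℤ, curv3 (facetVector (center x) (disp x) ε) = n)
    {g : (Fin 5 → ℝ) ≃ₗ[ℝ] (Fin 5 → ℝ)} (hg : g ∈ Subgroup.closure (orthoGens x))
    (z : Fin 5 → ℝ) :
    ((∃ n : ℤ, curv3 (g z) = n) ∧
        ∀ ε, ∃ n : ℤ, Q3 (g z) (facetVector (center x) (disp x) ε) = n) ↔
      (∃ n : ℤ, curv3 z = n) ∧ ∀ ε, ∃ n : ℤ, Q3 z (facetVector (center x) (disp x) ε) = n := by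
  induction hg using Subgroup.closure_induction generalizing z with
  | one => rfl
  | mul a b _ _ ha hb => rw [LinearEquiv.mul_apply, ha, hb]
  | inv a _ ha => rw [← ha, ← LinearEquiv.mul_apply, mul_inv_cancel, LinearEquiv.coe_one, id]
  | mem g hg =>
    obtain ⟨w, hww, ⟨ε, hε⟩, hgw⟩ := hg
    have hinv : g (g z) = z := by
      rw [hgw (g z), hgw z, Q3_sub_left, Q3_smul_left, hww]
      module
    simp only [hx.eq_center_add] at hε
    obtain ⟨a, ha, rfl⟩ := hx.isOrthoFrame.eq_smul_facetVector hww hε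
    have hgf : ∀ y, g y = y - (2 * Q3 y (facetVector (center x) (disp x) ε)) •
        facetVector (center x) (disp x) ε := by
      intro y
      rw [hgw, Q3_smul_right, smul_smul]
      congr 2
      linear_combination 2 * Q3 y (facetVector (center x) (disp x) ε) * ha
    have hpres : ∀ y, ((∃ n : ℤ, curv3 y = n) ∧
          ∀ δ, ∃ n : ℤ, Q3 y (facetVector (center x) (disp x) δ) = n) →
        (∃ n : ℤ, curv3 (g y) = n) ∧
          ∀ δ, ∃ n : ℤ, Q3 (g y) (facetVector (center x) (disp x) δ) = n := by
      rintro y ⟨⟨k, hk⟩, hy⟩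
      obtain ⟨q, hq⟩ := hy ε
      refine ⟨?_, fun δ => ?_⟩
      · obtain ⟨c, hc⟩ := hw ε
        exact ⟨k - 2 * q * c, by rw [hgf, curv3_sub, curv3_smul, hk, hq, hc]; push_cast; ring⟩
      · obtain ⟨p, hp⟩ := hy δ
        obtain ⟨c, hc⟩ := hx.isOrthoFrame.exists_Q3_facetVector ε δ
        exact ⟨p - 2 * q * c, by rw [hgf, Q3_sub_left, Q3_smul_left, hp, hq, hc]; push_cast; ring⟩
    exact ⟨fun h => hinv ▸ hpres _ h, hpres z⟩

theorem mem_orthoOmega (k : Fin 4 × Bool) : x k ∈ orthoOmega x :=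
  ⟨1, one_mem _, k, rfl⟩

theorem curv3_vertex (i : Fin 4) :
    curv3 (x (i, true)) = curv3 (center x) + curv3 (disp x i) := by
  rw [← curv3_add, disp, add_sub_cancel]

/-- The quadratic expression in the curvatures is the square of an affine one. -/
theorem sum_curv3_relation (hx : IsOrthoPacking x) :
    (∑ i : Fin 4, curv3 (x (i, true))) ^ 2 - 2 * ∑ i : Fin 4, (curv3 (x (i, true))) ^ 2 =
      (2 * curv3 (center x) - ∑ i : Fin 4, curv3 (x (i, true))) ^ 2 := by
  have hrel := hx.isOrthoFrame.curv3_relation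
  simp only [curv3_vertex, Fin.sum_univ_four] at hrel ⊢
  linear_combination 2 * hrel

end IsOrthoPacking

open IsOrthoPacking

/-- Integrality criterion for orthoplicial Apollonian sphere packings: the packing is integral
iff the curvatures κ₁,κ₂,κ₃,κ₄ of four pairwise tangent spheres are integers and
`(κ₁+κ₂+κ₃+κ₄)² − 2(κ₁²+κ₂²+κ₃²+κ₄²)` is four times a perfect square. -/
theorem orthoplicial_integrality (x : Fin 4 × Bool → (Fin 5 → ℝ)) (hx : IsOrthoPacking x) :
    (∀ b ∈ orthoOmega x, ∃ n : ℤ, curv3 b = n) ↔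
      ((∀ i : Fin 4, ∃ m : ℤ, curv3 (x (i, true)) = m) ∧
        ∃ n : ℤ, 4 * (n : ℝ) ^ 2 =
          (∑ i : Fin 4, curv3 (x (i, true))) ^ 2 -
            2 * ∑ i : Fin 4, (curv3 (x (i, true))) ^ 2) := by
  have hvertex : ∀ i, center x + disp x i = x (i, true) := fun i => add_sub_cancel _ _
  rw [hx.sum_curv3_relation]
  constructor
  · intro h
    have hk : ∀ k, ∃ n : ℤ, curv3 (x k) = n := fun k => h _ (mem_orthoOmega k)
    refine ⟨fun i => hk _, ?_⟩
    have hm : ∃ n : ℤ, 2 * curv3 (center x) = n := by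
      obtain ⟨a, ha⟩ := hk (0, true)
      obtain ⟨b, hb⟩ := hk (0, false)
      refine ⟨a + b, ?_⟩
      rw [← curv3_smul, ← hx.add_opposite 0, curv3_add, ha, hb]
      push_cast
      rfl
    obtain ⟨n, hn⟩ := (hx.isOrthoFrame.exists_curv3_eq
      (fun i => by rw [hvertex]; exact hk _) hm).2.2 fun _ => true
    refine ⟨n, ?_⟩
    rw [← hn, curv3_facetVector]
    simp only [curv3_vertex, Fin.sum_univ_four, boolSign, if_true]
    ring
  · rintro ⟨hk, n, hn⟩
    have hm : ∃ p : ℤ, 2 * curv3 (center x) = p := by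
      choose k hk' using hk
      simp only [hk'] at hn
      have hsq : (2 * curv3 (center x) - ∑ i, (k i : ℝ)) ^ 2 = (2 * n : ℝ) ^ 2 := by
        rw [← hn]; ring
      rcases sq_eq_sq_iff_eq_or_eq_neg.1 hsq with h | h
      · exact ⟨∑ i, k i + 2 * n, by push_cast; linarith⟩
      · exact ⟨∑ i, k i - 2 * n, by push_cast; linarith⟩
    obtain ⟨⟨p, hp⟩, hd, hw⟩ := hx.isOrthoFrame.exists_curv3_eq
      (fun i => by rw [hvertex]; exact hk i) hm
    rintro _ ⟨g, hg, ⟨i, b⟩, rfl⟩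
    refine ((hx.integral_apply_iff hw hg _).2 ⟨?_, fun ε => ?_⟩).1
    · obtain ⟨q, hq⟩ := hd i
      obtain ⟨c, hc⟩ := exists_boolSign_eq b
      refine ⟨p + (1 - 2 * c) * q, ?_⟩
      rw [hx.eq_center_add, curv3_add, curv3_smul, hp, hq, hc]
      push_cast
      rfl
    · rw [hx.eq_center_add]
      exact hx.isOrthoFrame.exists_Q3_vertex_facetVector i b ε
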